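/- Let p,q ≥ 1, let π ∈ S_ann-nc(p,q) and ρ ∈ S_disc-nc(p,q) with π ⪯ ρ̂ in S_nc-sd(p,q). Let I be the set of elements lying in bridges of Kr_{p,q}⁻¹(π) = τ_{p,q}π⁻¹, let J be the union of the two cycles of ρ containing the bridges of π, and let K := I ∩ J. Then K is the union of exactly two cycles of Kr_ρ⁻¹(π₀) = ρπ₀⁻¹, one contained in each cycle of τ_{p,q}. -/

import Mathlib

namespace AnnNC

/-- The orbit ("same cycle") setoid of a permutation. -/
def orbitSetoid {α : Type*} (σ : Equiv.Perm α) : Setoid α :=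
  ⟨σ.SameCycle, ⟨fun x => Equiv.Perm.SameCycle.refl σ x,
    fun h => h.symm, fun h h' => h.trans h'⟩⟩

/-- Number of orbits (cycles, counting fixed points) of a permutation. -/
noncomputable def numOrbits {α : Type*} (σ : Equiv.Perm α) : ℕ :=
  Nat.card (Quotient (orbitSetoid σ))

/-- Number of blocks of the join `Π(σ) ∨ Π(ρ)` of the orbit partitions. -/
noncomputable def numJoin {α : Type*} (σ ρ : Equiv.Perm α) : ℕ :=
  Nat.card (Quotient (orbitSetoid σ ⊔ orbitSetoid ρ))

/-- Euler characteristic `χ_ρ(π) = #(ρ) + #(π) + #(π⁻¹ρ) − n`. -/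
noncomputable def euler {α : Type*} (ρ π : Equiv.Perm α) : ℤ :=
  (numOrbits ρ : ℤ) + (numOrbits π : ℤ) + (numOrbits (π⁻¹ * ρ) : ℤ) - (Nat.card α : ℤ)

/-- `π` is noncrossing on `ρ`. -/
def IsNoncrossingOn {α : Type*} (π ρ : Equiv.Perm α) : Prop :=
  euler ρ π = 2 * (numJoin π ρ : ℤ)

/-- Euler characteristic of permutations regarded as permutations of a subset `S`
(for permutations fixing the complement of `S` pointwise). -/
noncomputable def eulerOn {α : Type*} (S : Set α) (ρ π : Equiv.Perm α) : ℤ :=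
  ((numOrbits ρ : ℤ) - (Nat.card (Sᶜ : Set α) : ℤ)) +
    ((numOrbits π : ℤ) - (Nat.card (Sᶜ : Set α) : ℤ)) +
    ((numOrbits (π⁻¹ * ρ) : ℤ) - (Nat.card (Sᶜ : Set α) : ℤ)) - (Nat.card (S : Set α) : ℤ)

/-- `π` is noncrossing on `ρ`, both regarded as permutations of the subset `S`. -/
def IsNoncrossingWithin {α : Type*} (S : Set α) (π ρ : Equiv.Perm α) : Prop :=
  eulerOn S ρ π = 2 * ((numJoin π ρ : ℤ) - (Nat.card (Sᶜ : Set α) : ℤ))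

/-- `τ_{p,q} = (1,…,p)(p+1,…,p+q)` as a permutation of `Fin (p+q)`. -/
def tauPQ (p q : ℕ) : Equiv.Perm (Fin (p + q)) :=
  Equiv.permCongr finSumFinEquiv (Equiv.sumCongr (finRotate p) (finRotate q))

/-- Disc-noncrossing permutations: noncrossing on `τ_{p,q}` and the orbit partition
refines that of `τ_{p,q}`. -/
def SDiscNC (p q : ℕ) : Set (Equiv.Perm (Fin (p + q))) :=
  {π | IsNoncrossingOn π (tauPQ p q) ∧
    ∀ x y : Fin (p + q), π.SameCycle x y → ((x : ℕ) < p ↔ (y : ℕ) < p)}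

/-- Annular-noncrossing permutations: noncrossing on `τ_{p,q}` with at least one bridge. -/
def SAnnNC (p q : ℕ) : Set (Equiv.Perm (Fin (p + q))) :=
  {π | IsNoncrossingOn π (tauPQ p q) ∧
    ∃ a b : Fin (p + q), π.SameCycle a b ∧ (a : ℕ) < p ∧ p ≤ (b : ℕ)}

/-- The set of elements lying in bridges of `σ`. -/
def BridgeSet (p q : ℕ) (σ : Equiv.Perm (Fin (p + q))) : Set (Fin (p + q)) :=
  {x | ∃ a b : Fin (p + q), σ.SameCycle x a ∧ σ.SameCycle x b ∧ (a : ℕ) < p ∧ p ≤ (b : ℕ)}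

/-- `π₀` is the permutation induced by `π` on the partition `Π(τ_{p,q})`
(the first–return map of `π` to each of the two sides). -/
def IsPiZero (p q : ℕ) (π π₀ : Equiv.Perm (Fin (p + q))) : Prop :=
  ∀ a : Fin (p + q), ∃ k : ℕ, 0 < k ∧ π₀ a = (π ^ k) a ∧
    (((a : ℕ) < p) ↔ (((π ^ k) a : ℕ) < p)) ∧
    ∀ j : ℕ, 0 < j → j < k → ¬ (((a : ℕ) < p) ↔ (((π ^ j) a : ℕ) < p))

/-- The order `π ⪯ ρ` for (unhatted) permutations: the orbit partition of `π` refines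
that of `ρ` and `π` is noncrossing on `ρ`. -/
def permLe {α : Type*} (π ρ : Equiv.Perm α) : Prop :=
  (∀ x y : α, π.SameCycle x y → ρ.SameCycle x y) ∧ IsNoncrossingOn π ρ

/-- The order relation `π ⪯ ρ̂` in `S_nc-sd(p,q)`, i.e. `Kr(ρ) ⪯ Kr(π)`. -/
def leAnnHat (p q : ℕ) (π ρ : Equiv.Perm (Fin (p + q))) : Prop :=
  permLe (ρ⁻¹ * tauPQ p q) (π⁻¹ * tauPQ p q)

/-- `σ` is the permutation induced by `π` on the subset `J` (first-return map),
extended by the identity off `J`. -/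
def IsInducedOn {α : Type*} (π σ : Equiv.Perm α) (J : Set α) : Prop :=
  (∀ a ∉ J, σ a = a) ∧
  ∀ a ∈ J, ∃ k : ℕ, 0 < k ∧ σ a = (π ^ k) a ∧ (π ^ k) a ∈ J ∧
    ∀ j : ℕ, 0 < j → j < k → (π ^ j) a ∉ J

/-- The size of an orbit of a permutation. -/
noncomputable def orbitSize {α : Type*} (σ : Equiv.Perm α) (c : Quotient (orbitSetoid σ)) : ℕ :=
  Nat.card {x : α // Quotient.mk (orbitSetoid σ) x = c}

/-- `∏_{U ∈ Π(σ)} (−1)^{|U|−1} C_{|U|−1}`. -/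
noncomputable def catProd {α : Type*} (σ : Equiv.Perm α) : ℤ :=
  ∏ᶠ c : Quotient (orbitSetoid σ),
    ((-1 : ℤ) ^ (orbitSize σ c - 1) * (catalan (orbitSize σ c - 1) : ℤ))

/-- The carrier of the poset `S_nc-sd(p,q)`: pairs (permutation, hatted?). -/
def NCSDSet (p q : ℕ) : Set (Equiv.Perm (Fin (p + q)) × Bool) :=
  {z | (z.2 = false ∧ (z.1 ∈ SDiscNC p q ∪ SAnnNC p q)) ∨ (z.2 = true ∧ z.1 ∈ SDiscNC p q)}

/-- The partial order of `S_nc-sd(p,q)`. -/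
def ncsdLe (p q : ℕ) (a b : Equiv.Perm (Fin (p + q)) × Bool) : Prop :=
  (a.2 = false ∧ b.2 = false ∧ permLe a.1 b.1) ∨
  (b.2 = true ∧ permLe (b.1⁻¹ * tauPQ p q) (a.1⁻¹ * tauPQ p q))

end AnnNC

namespace AnnNC

section Classes

variable {α : Type*}

/-- Number of classes of `r` meeting `S`. -/
noncomputable def classCount (r : Setoid α) (S : Set α) : ℕ :=
  (Quotient.mk r '' S).ncard

theorem classCount_univ (σ : Equiv.Perm α) :
    classCount (orbitSetoid σ) Set.univ = numOrbits σ := by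
  rw [classCount, Set.image_univ, Set.range_eq_univ.2 Quotient.mk_surjective, Set.ncard_univ]
  rfl

theorem classCount_eq_card_comap (r : Setoid α) (S : Set α) :
    classCount r S = Nat.card (Quotient (r.comap (Subtype.val : S → α))) := by
  rw [Nat.card_congr (Setoid.comapQuotientEquiv _ _), classCount, ← Nat.card_coe_set_eq]
  congr 2
  ext c
  simp

theorem classCount_congr {r s : Setoid α} {S : Set α}
    (h : ∀ x ∈ S, ∀ y ∈ S, (r x y ↔ s x y)) : classCount r S = classCount s S := by
  have : r.comap (Subtype.val : S → α) = s.comap (Subtype.val : S → α) := by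
    ext x y
    exact h x x.2 y y.2
  rw [classCount_eq_card_comap, classCount_eq_card_comap, this]

theorem classCount_union [Finite α] {r : Setoid α} {S T : Set α}
    (h : ∀ x ∈ S, ∀ y ∈ T, ¬ r x y) :
    classCount r (S ∪ T) = classCount r S + classCount r T := by
  rw [classCount, Set.image_union]
  refine Set.ncard_union_eq (Set.disjoint_left.2 ?_) (Set.toFinite _) (Set.toFinite _)
  rintro _ ⟨x, hx, rfl⟩ ⟨y, hy, hxy⟩
  exact h x hx y hy (Quotient.exact hxy.symm)

theorem one_le_classCount [Finite α] {r : Setoid α} {S : Set α} (h : S.Nonempty) :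
    1 ≤ classCount r S :=
  (Set.ncard_pos (Set.toFinite _)).2 (h.image _)

theorem rel_of_classCount_le_one [Finite α] {r : Setoid α} {S : Set α} (h : classCount r S ≤ 1)
    {x y : α} (hx : x ∈ S) (hy : y ∈ S) : r x y :=
  Quotient.exact ((Set.ncard_le_one (Set.toFinite _)).1 h _ ⟨x, hx, rfl⟩ _ ⟨y, hy, rfl⟩)

theorem numOrbits_eq_add [Finite α] {σ : Equiv.Perm α} {S : Set α}
    (h : ∀ x ∈ S, ∀ y, σ.SameCycle x y → y ∈ S) :
    numOrbits σ = classCount (orbitSetoid σ) S + classCount (orbitSetoid σ) Sᶜ := by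
  rw [← classCount_univ, ← Set.union_compl_self S, classCount_union]
  exact fun x hx y hy hxy => hy (h x hx y hxy)

end Classes

section Invariant

variable {α : Type*}

/-- Rational functions invariant under a permutation. -/
def invariants (σ : Equiv.Perm α) : Submodule ℚ (α → ℚ) where
  carrier := {f | ∀ x, f (σ x) = f x}
  add_mem' := fun hf hg x => by simp [hf x, hg x]
  zero_mem' := fun _ => rfl
  smul_mem' := fun c f hf x => by simp [hf x]

theorem mem_invariants {σ : Equiv.Perm α} {f : α → ℚ} :
    f ∈ invariants σ ↔ ∀ x, f (σ x) = f x := Iff.rfl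

theorem eq_of_sameCycle {σ : Equiv.Perm α} {f : α → ℚ} (hf : f ∈ invariants σ) {x y : α}
    (h : σ.SameCycle x y) : f x = f y := by
  obtain ⟨i, rfl⟩ := h
  induction i using Int.induction_on with
  | zero => simp
  | succ n ih => rw [add_comm, zpow_add, zpow_one, Equiv.Perm.mul_apply, hf, ih]
  | pred n ih =>
    rw [ih, ← hf ((σ ^ (-(n : ℤ) - 1)) x), ← Equiv.Perm.mul_apply, ← zpow_one_add]
    congr 3
    ring

theorem sameCycle_of_forall_eq {σ : Equiv.Perm α} {x y : α}
    (h : ∀ f ∈ invariants σ, f x = f y) : σ.SameCycle x y := by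
  classical
  have := h (fun z => if σ.SameCycle x z then 1 else 0)
    (fun z => by simp [Equiv.Perm.sameCycle_apply_right])
  by_contra hxy
  simp [hxy, Equiv.Perm.SameCycle.refl] at this

/-- Invariant functions are the functions on the set of orbits. -/
noncomputable def invariantsEquiv (σ : Equiv.Perm α) :
    invariants σ ≃ₗ[ℚ] (Quotient (orbitSetoid σ) → ℚ) where
  toFun f := Quotient.lift f.1 fun _ _ h => eq_of_sameCycle f.2 h
  invFun g := ⟨fun x => g (Quotient.mk _ x), fun x => congrArg g
    (Quotient.sound (Equiv.Perm.sameCycle_apply_left.2 (Equiv.Perm.SameCycle.refl σ x)))⟩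
  left_inv _ := rfl
  right_inv g := by
    ext c
    induction c using Quotient.inductionOn
    rfl
  map_add' f g := by
    ext c
    induction c using Quotient.inductionOn
    rfl
  map_smul' a f := by
    ext c
    induction c using Quotient.inductionOn
    rfl

variable [Finite α]

theorem finrank_invariants (σ : Equiv.Perm α) :
    Module.finrank ℚ (invariants σ) = numOrbits σ := by
  have := Fintype.ofFinite (Quotient (orbitSetoid σ))
  rw [(invariantsEquiv σ).finrank_eq, Module.finrank_fintype_fun_eq_card, numOrbits,
    Nat.card_eq_fintype_card]

theorem finrank_sup_le (σ ρ : Equiv.Perm α) :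
    Module.finrank ℚ ↥(invariants σ ⊔ invariants ρ) ≤ Nat.card α := by
  have := Fintype.ofFinite α
  refine (Submodule.finrank_le _).trans_eq ?_
  rw [Module.finrank_fintype_fun_eq_card, Nat.card_eq_fintype_card]

omit [Finite α] in
theorem inf_le_invariants_mul (σ ρ : Equiv.Perm α) :
    invariants σ ⊓ invariants ρ ≤ invariants (σ * ρ) := fun f hf x => by
  rw [Equiv.Perm.mul_apply, hf.1, hf.2]

theorem finrank_sup_add_inf (σ ρ : Equiv.Perm α) :
    Module.finrank ℚ ↥(invariants σ ⊔ invariants ρ) +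
      Module.finrank ℚ ↥(invariants σ ⊓ invariants ρ) = numOrbits σ + numOrbits ρ := by
  rw [Submodule.finrank_sup_add_finrank_inf_eq, finrank_invariants, finrank_invariants]

/-- The triangle inequality for the length `n - #(σ)`. -/
theorem numOrbits_add_le (σ ρ : Equiv.Perm α) :
    numOrbits σ + numOrbits ρ ≤ Nat.card α + numOrbits (σ * ρ) := by
  have h := Submodule.finrank_mono (inf_le_invariants_mul σ ρ)
  rw [finrank_invariants] at h
  have := finrank_sup_add_inf σ ρ
  have := finrank_sup_le σ ρ
  omega

variable {σ ρ : Equiv.Perm α} (h : Nat.card α + numOrbits (σ * ρ) ≤ numOrbits σ + numOrbits ρ)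
include h

theorem inf_eq_invariants_mul : invariants σ ⊓ invariants ρ = invariants (σ * ρ) := by
  refine Submodule.eq_of_le_of_finrank_le (inf_le_invariants_mul σ ρ) ?_
  rw [finrank_invariants]
  have := finrank_sup_add_inf σ ρ
  have := finrank_sup_le σ ρ
  omega

theorem invariants_sup_eq_top : invariants σ ⊔ invariants ρ = ⊤ := by
  have := Fintype.ofFinite α
  refine Submodule.eq_top_of_finrank_eq ?_
  have h1 := Submodule.finrank_mono (inf_le_invariants_mul σ ρ)
  rw [finrank_invariants] at h1
  have h2 := finrank_sup_add_inf σ ρ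
  have h3 := finrank_sup_le σ ρ
  rw [Module.finrank_fintype_fun_eq_card, ← Nat.card_eq_fintype_card]
  omega

theorem sameCycle_mul_of_left {x y : α} (hxy : σ.SameCycle x y) : (σ * ρ).SameCycle x y :=
  sameCycle_of_forall_eq fun _ hf => eq_of_sameCycle ((inf_eq_invariants_mul h).ge hf).1 hxy

theorem sameCycle_mul_of_right {x y : α} (hxy : ρ.SameCycle x y) : (σ * ρ).SameCycle x y :=
  sameCycle_of_forall_eq fun _ hf => eq_of_sameCycle ((inf_eq_invariants_mul h).ge hf).2 hxy

/-- If `σρ` is a geodesic product and the orbits of `β` refine those of `ρ`, then an orbit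
of `ρ` and an orbit of `σβ` meet inside a single orbit of `β`. -/
theorem sameCycle_of_sameCycle_mul {β : Equiv.Perm α}
    (hβ : ∀ x y, β.SameCycle x y → ρ.SameCycle x y) {x y : α} (h1 : ρ.SameCycle x y)
    (h2 : (σ * β).SameCycle x y) : β.SameCycle x y := by
  refine sameCycle_of_forall_eq fun f hf => ?_
  obtain ⟨k, hk, g, hg, rfl⟩ := Submodule.mem_sup.1
    ((invariants_sup_eq_top h).ge (Submodule.mem_top (x := f)))
  have hgβ : g ∈ invariants β := fun z =>
    (eq_of_sameCycle hg (hβ _ _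
      (Equiv.Perm.sameCycle_apply_right.2 (Equiv.Perm.SameCycle.refl β z)))).symm
  have hkβ : k ∈ invariants β := by
    have := (invariants β).sub_mem hf hgβ
    rwa [add_sub_cancel_right] at this
  rw [Pi.add_apply, Pi.add_apply, eq_of_sameCycle hg h1,
    eq_of_sameCycle (inf_le_invariants_mul _ _ ⟨hk, hkβ⟩) h2]

end Invariant

section FirstReturn

variable {α : Type*} {P : α → Prop}

/-- `σ₀` is the permutation induced by `σ` on the two sides `P` and `¬ P`. -/
def IsSideReturn (P : α → Prop) (σ σ₀ : Equiv.Perm α) : Prop :=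
  ∀ a, ∃ k : ℕ, 0 < k ∧ σ₀ a = (σ ^ k) a ∧ (P a ↔ P ((σ ^ k) a)) ∧
    ∀ j : ℕ, 0 < j → j < k → ¬ (P a ↔ P ((σ ^ j) a))

/-- The elements of the cycles of `σ` meeting both sides. -/
def bridges (P : α → Prop) (σ : Equiv.Perm α) : Set α :=
  {x | ∃ a b, σ.SameCycle x a ∧ σ.SameCycle x b ∧ P a ∧ ¬ P b}

theorem exists_isSideReturn [Finite α] (P : α → Prop) (σ : Equiv.Perm α) :
    ∃ σ₀, IsSideReturn P σ σ₀ := by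
  classical
  have hex : ∀ a, ∃ k : ℕ, 0 < k ∧ (P a ↔ P ((σ ^ k) a)) := fun a =>
    ⟨orderOf σ, orderOf_pos σ, by simp [pow_orderOf_eq_one]⟩
  set f : α → α := fun a => (σ ^ Nat.find (hex a)) a with hf
  have key : ∀ a b, Nat.find (hex a) ≤ Nat.find (hex b) → f a = f b → a = b := by
    intro a b hle hab
    have ha := (Nat.find_spec (hex a)).2
    have hb := (Nat.find_spec (hex b)).2
    have e : a = (σ ^ (Nat.find (hex b) - Nat.find (hex a))) b := by
      apply (σ ^ Nat.find (hex a)).injective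
      rw [← Equiv.Perm.mul_apply, ← pow_add, Nat.add_sub_cancel' hle]
      exact hab
    rcases Nat.eq_zero_or_pos (Nat.find (hex b) - Nat.find (hex a)) with h0 | h0
    · rwa [h0] at e
    · have := Nat.find_min (hex b)
        (Nat.sub_lt (Nat.find_spec (hex b)).1 (Nat.find_spec (hex a)).1)
      refine absurd ⟨h0, ?_⟩ this
      rw [← e, ha, hb]
      exact iff_of_eq (congrArg P hab.symm)
  have hinj : Function.Injective f := fun a b hab =>
    (le_total _ _).elim (fun h => key a b h hab) fun h => (key b a h hab.symm).symm
  refine ⟨Equiv.ofBijective f (Finite.injective_iff_bijective.1 hinj), fun a =>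
    ⟨Nat.find (hex a), (Nat.find_spec (hex a)).1, rfl, (Nat.find_spec (hex a)).2,
      fun j h0 hj h => Nat.find_min (hex a) hj ⟨h0, h⟩⟩⟩

variable {σ σ₀ : Equiv.Perm α} (h : IsSideReturn P σ σ₀)
include h

theorem IsSideReturn.side_apply (x : α) : P (σ₀ x) ↔ P x := by
  obtain ⟨k, -, e, hk, -⟩ := h x
  rw [e, hk]

theorem IsSideReturn.apply_eq {x : α} (hx : P (σ x) ↔ P x) : σ₀ x = σ x := by
  obtain ⟨k, h0, e, hk, hmin⟩ := h x
  rcases (show 1 ≤ k from h0).eq_or_lt with h1 | h1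
  · rw [e, ← h1, pow_one]
  · exact absurd (by rw [pow_one, hx]) (hmin 1 one_pos h1)

variable [Finite α]

theorem IsSideReturn.sameCycle_iff {x y : α} (hxy : P x ↔ P y) :
    σ₀.SameCycle x y ↔ σ.SameCycle x y := by
  constructor
  · intro hc
    refine sameCycle_of_forall_eq fun f hf => eq_of_sameCycle (σ := σ₀) (fun z => ?_) hc
    obtain ⟨k, -, e, -⟩ := h z
    rw [e]
    exact (eq_of_sameCycle hf ⟨k, by simp⟩).symm
  · intro hc
    obtain ⟨n, -, -, rfl⟩ := hc.exists_pow_eq'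
    clear hc
    induction n using Nat.strong_induction_on generalizing x with
    | _ n ih =>
      rcases Nat.eq_zero_or_pos n with rfl | hn
      · exact Equiv.Perm.SameCycle.refl _ _
      obtain ⟨k, h0, e, hk, hmin⟩ := h x
      have hle : k ≤ n := not_lt.1 fun hlt => hmin n hn hlt hxy
      have e' : (σ ^ n) x = (σ ^ (n - k)) (σ₀ x) := by
        rw [e, ← Equiv.Perm.mul_apply, ← pow_add, Nat.sub_add_cancel hle]
      rw [e', ← Equiv.Perm.sameCycle_apply_left]
      exact ih (n - k) (by omega) (by rw [← e', h.side_apply, hxy])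

end FirstReturn

section Bridges

variable {α : Type*} {P : α → Prop}

theorem bridges_closed {σ : Equiv.Perm α} {x y : α} (hx : x ∈ bridges P σ)
    (h : σ.SameCycle x y) : y ∈ bridges P σ := by
  obtain ⟨a, b, ha, hb, h1, h2⟩ := hx
  exact ⟨a, b, h.symm.trans ha, h.symm.trans hb, h1, h2⟩

theorem side_iff_of_notMem_bridges {σ : Equiv.Perm α} {x y : α} (hx : x ∉ bridges P σ)
    (h : σ.SameCycle x y) : P x ↔ P y := by
  by_contra hc
  refine hx ?_
  by_cases h1 : P x
  · exact ⟨x, y, Equiv.Perm.SameCycle.refl σ x, h, h1, fun h2 => hc (by tauto)⟩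
  · exact ⟨y, x, h, Equiv.Perm.SameCycle.refl σ x, by tauto, h1⟩

theorem bridges_inv (σ : Equiv.Perm α) : bridges P σ⁻¹ = bridges P σ := by
  simp only [bridges, Equiv.Perm.sameCycle_inv]

theorem side_of_sameCycle {σ : Equiv.Perm α} (hσ : ∀ x, P (σ x) ↔ P x) {x y : α}
    (h : σ.SameCycle x y) : P x ↔ P y := by
  classical
  have := eq_of_sameCycle (f := fun z => if P z then 1 else 0) (fun z => by simp [hσ]) h
  by_cases h1 : P x <;> by_cases h2 : P y <;> simp_all

theorem mem_bridges_of_side_ne {σ : Equiv.Perm α} {x : α} (h : ¬ (P (σ x) ↔ P x)) :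
    x ∈ bridges P σ := by
  by_contra hx
  exact h (side_iff_of_notMem_bridges hx
    (Equiv.Perm.sameCycle_apply_right.2 (Equiv.Perm.SameCycle.refl σ x))).symm

theorem orbitSetoid_inv (σ : Equiv.Perm α) : orbitSetoid σ⁻¹ = orbitSetoid σ := by
  ext x y
  exact Equiv.Perm.sameCycle_inv

theorem numOrbits_inv (σ : Equiv.Perm α) : numOrbits σ⁻¹ = numOrbits σ := by
  rw [numOrbits, numOrbits, orbitSetoid_inv]

theorem numOrbits_conj (σ τ : Equiv.Perm α) : numOrbits (τ * σ * τ⁻¹) = numOrbits σ := by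
  refine Nat.card_congr (Quotient.congr (τ⁻¹ : Equiv.Perm α) fun x y => ?_)
  exact Equiv.Perm.sameCycle_conj

variable [Finite α]

/-- A permutation with a bridge has a crossing from either side to the other. -/
theorem exists_crossing {σ : Equiv.Perm α} (h : (bridges P σ).Nonempty) :
    ∃ x, P x ∧ ¬ P (σ x) := by
  obtain ⟨x, a, b, ha, hb, h1, h2⟩ := h
  by_contra! hc
  obtain ⟨n, -, -, rfl⟩ := (ha.symm.trans hb).exists_pow_eq'
  refine h2 ?_
  clear h2 hb
  induction n with
  | zero => exact h1
  | succ n ih => rw [pow_succ']; exact hc _ ih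

omit [Finite α] in
theorem bridges_compl (σ : Equiv.Perm α) : bridges (fun x => ¬ P x) σ = bridges P σ := by
  ext x
  exact ⟨fun ⟨a, b, ha, hb, h1, h2⟩ => ⟨b, a, hb, ha, not_not.1 h2, h1⟩,
    fun ⟨a, b, ha, hb, h1, h2⟩ => ⟨b, a, hb, ha, h2, not_not.2 h1⟩⟩

theorem exists_crossing' {σ : Equiv.Perm α} (h : (bridges P σ).Nonempty) :
    ∃ x, ¬ P x ∧ P (σ x) := by
  rw [← bridges_compl] at h
  simpa using exists_crossing h

theorem numOrbits_sideReturn {σ σ₀ : Equiv.Perm α} (h : IsSideReturn P σ σ₀) :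
    numOrbits σ₀ = numOrbits σ + classCount (orbitSetoid σ) (bridges P σ) := by
  have hside : ∀ {x y : α}, σ₀.SameCycle x y → (P x ↔ P y) := side_of_sameCycle h.side_apply
  have hcong : ∀ S : Set α, (∀ x ∈ S, ∀ y ∈ S, σ.SameCycle x y → (P x ↔ P y)) →
      classCount (orbitSetoid σ₀) S = classCount (orbitSetoid σ) S := fun S hS =>
    classCount_congr fun x hx y hy =>
      ⟨fun hc => (h.sameCycle_iff (hside hc)).1 hc,
        fun hc => (h.sameCycle_iff (hS x hx y hy hc)).2 hc⟩
  have hpart : ∀ Q : Set α, (∀ x ∈ Q, ∀ y ∈ Q, P x ↔ P y) →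
      (∀ x ∈ bridges P σ, ∃ y ∈ Q, σ.SameCycle x y) →
      classCount (orbitSetoid σ₀) (bridges P σ ∩ Q) =
        classCount (orbitSetoid σ) (bridges P σ) := by
    intro Q hQ hex
    rw [hcong _ fun x hx y hy _ => hQ x hx.2 y hy.2, classCount, classCount]
    congr 1
    refine Set.Subset.antisymm (Set.image_mono Set.inter_subset_left) ?_
    rintro _ ⟨x, hx, rfl⟩
    obtain ⟨y, hy, hxy⟩ := hex x hx
    exact ⟨y, ⟨bridges_closed hx hxy, hy⟩, Quotient.sound hxy.symm⟩
  have hsplit : bridges P σ = (bridges P σ ∩ {x | P x}) ∪ (bridges P σ ∩ {x | ¬ P x}) := by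
    rw [← Set.inter_union_distrib_left]
    refine (Set.inter_eq_left.2 fun x _ => em (P x)).symm
  have e1 := numOrbits_eq_add (σ := σ) (S := bridges P σ) fun x hx y => bridges_closed hx
  have e2 := numOrbits_eq_add (σ := σ₀) (S := bridges P σ) fun x hx y hc =>
    bridges_closed hx ((h.sameCycle_iff (hside hc)).1 hc)
  have e3 : classCount (orbitSetoid σ₀) (bridges P σ) =
      classCount (orbitSetoid σ₀) (bridges P σ ∩ {x | P x}) +
        classCount (orbitSetoid σ₀) (bridges P σ ∩ {x | ¬ P x}) := by
    conv_lhs => rw [hsplit]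
    exact classCount_union fun x hx y hy hc => hy.2 ((hside hc).1 hx.2)
  have e4 := hcong (bridges P σ)ᶜ fun x hx y _ hc => side_iff_of_notMem_bridges hx hc
  have e5 := hpart {x | P x} (fun x hx y hy => iff_of_true hx hy)
    fun x ⟨a, b, ha, hb, h1, h2⟩ => ⟨a, h1, ha⟩
  have e6 := hpart {x | ¬ P x} (fun x hx y hy => iff_of_false hx hy)
    fun x ⟨a, b, ha, hb, h1, h2⟩ => ⟨b, h2, hb⟩
  omega

section Complement

variable {ρ π π₀ : Equiv.Perm α} (hρ : ∀ x, P (ρ x) ↔ P x) (h₀ : IsSideReturn P π π₀)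
include hρ

omit [Finite α] in
theorem side_inv_apply (x : α) : P (ρ⁻¹ x) ↔ P x := by
  rw [← hρ (ρ⁻¹ x), show ρ (ρ⁻¹ x) = x from ρ.apply_symm_apply x]

include h₀

omit [Finite α] in
theorem side_kreweras (x : α) : P ((ρ * π₀⁻¹) x) ↔ P x := by
  rw [Equiv.Perm.mul_apply, hρ, side_inv_apply h₀.side_apply]

omit [Finite α] in
theorem kreweras_apply_eq {x : α} (hx : x ∉ bridges P (ρ * π⁻¹)) :
    (ρ * π₀⁻¹) x = (ρ * π⁻¹) x := by
  have h1 : P ((ρ * π⁻¹) x) ↔ P x := by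
    by_contra hc
    exact hx (mem_bridges_of_side_ne hc)
  rw [Equiv.Perm.mul_apply, hρ] at h1
  rw [Equiv.Perm.mul_apply, Equiv.Perm.mul_apply]
  congr 1
  rw [Equiv.Perm.inv_eq_iff_eq, h₀.apply_eq, show π (π⁻¹ x) = x from π.apply_symm_apply x]
  rw [show π (π⁻¹ x) = x from π.apply_symm_apply x, h1]

theorem kreweras_sameCycle {x y : α} (hx : x ∉ bridges P (ρ * π⁻¹)) :
    (ρ * π₀⁻¹).SameCycle x y ↔ (ρ * π⁻¹).SameCycle x y := by
  have key : ∀ n : ℕ, ((ρ * π₀⁻¹) ^ n) x = ((ρ * π⁻¹) ^ n) x := by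
    intro n
    induction n with
    | zero => rfl
    | succ n ih =>
      rw [pow_succ', pow_succ', Equiv.Perm.mul_apply, Equiv.Perm.mul_apply _ _ x, ih]
      exact kreweras_apply_eq hρ h₀ fun hc =>
        hx (bridges_closed hc (Equiv.Perm.SameCycle.symm ⟨n, by simp⟩))
  constructor
  · intro h
    obtain ⟨n, -, -, rfl⟩ := h.exists_pow_eq'
    exact ⟨n, by simp [key]⟩
  · intro h
    obtain ⟨n, -, -, rfl⟩ := h.exists_pow_eq'
    exact ⟨n, by simp [key]⟩

theorem kreweras_closed {x y : α} (hx : x ∈ bridges P (ρ * π⁻¹))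
    (h : (ρ * π₀⁻¹).SameCycle x y) : y ∈ bridges P (ρ * π⁻¹) := by
  by_contra hy
  exact hy (bridges_closed hx ((kreweras_sameCycle hρ h₀ hy).1 h.symm).symm)

theorem numOrbits_kreweras :
    numOrbits (ρ * π₀⁻¹) + classCount (orbitSetoid (ρ * π⁻¹)) (bridges P (ρ * π⁻¹)) =
      numOrbits (ρ * π⁻¹) +
        (classCount (orbitSetoid (ρ * π₀⁻¹)) (bridges P (ρ * π⁻¹) ∩ {x | P x}) +
          classCount (orbitSetoid (ρ * π₀⁻¹)) (bridges P (ρ * π⁻¹) ∩ {x | ¬ P x})) := by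
  have hsplit : bridges P (ρ * π⁻¹) =
      (bridges P (ρ * π⁻¹) ∩ {x | P x}) ∪ (bridges P (ρ * π⁻¹) ∩ {x | ¬ P x}) := by
    rw [← Set.inter_union_distrib_left]
    refine (Set.inter_eq_left.2 fun x _ => em (P x)).symm
  have e1 := numOrbits_eq_add (σ := ρ * π⁻¹) (S := bridges P (ρ * π⁻¹))
    fun x hx y => bridges_closed hx
  have e2 := numOrbits_eq_add (σ := ρ * π₀⁻¹) (S := bridges P (ρ * π⁻¹))
    fun x hx y => kreweras_closed hρ h₀ hx
  have e3 : classCount (orbitSetoid (ρ * π₀⁻¹)) (bridges P (ρ * π⁻¹)) =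
      classCount (orbitSetoid (ρ * π₀⁻¹)) (bridges P (ρ * π⁻¹) ∩ {x | P x}) +
        classCount (orbitSetoid (ρ * π₀⁻¹)) (bridges P (ρ * π⁻¹) ∩ {x | ¬ P x}) := by
    conv_lhs => rw [hsplit]
    exact classCount_union fun x hx y hy hc =>
      hy.2 ((side_of_sameCycle (side_kreweras hρ h₀) hc).1 hx.2)
  have e4 : classCount (orbitSetoid (ρ * π₀⁻¹)) (bridges P (ρ * π⁻¹))ᶜ =
      classCount (orbitSetoid (ρ * π⁻¹)) (bridges P (ρ * π⁻¹))ᶜ :=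
    classCount_congr fun x hx y _ => kreweras_sameCycle hρ h₀ hx
  omega

omit h₀ in
theorem exists_mem_bridges_kreweras (hb : (bridges P π).Nonempty) :
    (∃ x ∈ bridges P π ∩ bridges P (ρ * π⁻¹), P x) ∧
      ∃ x ∈ bridges P π ∩ bridges P (ρ * π⁻¹), ¬ P x := by
  rw [← bridges_inv π] at hb ⊢
  have key : ∀ x, ¬ (P (π⁻¹ x) ↔ P x) → x ∈ bridges P π⁻¹ ∩ bridges P (ρ * π⁻¹) :=
    fun x hx => ⟨mem_bridges_of_side_ne hx,
      mem_bridges_of_side_ne (by rwa [Equiv.Perm.mul_apply, hρ])⟩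
  obtain ⟨x, h1, h2⟩ := exists_crossing hb
  obtain ⟨y, h3, h4⟩ := exists_crossing' hb
  exact ⟨⟨x, key x (by tauto), h1⟩, ⟨y, key y (by tauto), h3⟩⟩

/-- Cutting the bridges of `π` merges the bridges of the complement into at least two cycles. -/
theorem classCount_bridges_add_le (hb : (bridges P π).Nonempty)
    (hn : Nat.card α + numOrbits ρ ≤ numOrbits π + numOrbits (ρ * π⁻¹) + 2) :
    classCount (orbitSetoid π) (bridges P π) +
      (classCount (orbitSetoid (ρ * π₀⁻¹)) (bridges P (ρ * π⁻¹) ∩ {x | P x}) +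
        classCount (orbitSetoid (ρ * π₀⁻¹)) (bridges P (ρ * π⁻¹) ∩ {x | ¬ P x})) ≤
      classCount (orbitSetoid (ρ * π⁻¹)) (bridges P (ρ * π⁻¹)) + 2 ∧
    1 ≤ classCount (orbitSetoid (ρ * π₀⁻¹)) (bridges P (ρ * π⁻¹) ∩ {x | P x}) ∧
    1 ≤ classCount (orbitSetoid (ρ * π₀⁻¹)) (bridges P (ρ * π⁻¹) ∩ {x | ¬ P x}) := by
  obtain ⟨⟨x, hx, hx'⟩, ⟨y, hy, hy'⟩⟩ := exists_mem_bridges_kreweras hρ hb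
  refine ⟨?_, one_le_classCount ⟨x, hx.2, hx'⟩, one_le_classCount ⟨y, hy.2, hy'⟩⟩
  have e1 := numOrbits_sideReturn h₀
  have e2 := numOrbits_kreweras hρ h₀
  have e3 := numOrbits_add_le (ρ * π₀⁻¹) π₀
  rw [inv_mul_cancel_right] at e3
  omega

theorem kreweras_bridges (hb : (bridges P π).Nonempty)
    (hn : Nat.card α + numOrbits ρ ≤ numOrbits π + numOrbits (ρ * π⁻¹) + 2) :
    Nat.card α + numOrbits ρ ≤ numOrbits (ρ * π₀⁻¹) + numOrbits π₀ ∧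
      ∀ x ∈ bridges P (ρ * π⁻¹), ∀ y ∈ bridges P (ρ * π⁻¹), (P x ↔ P y) →
        (ρ * π₀⁻¹).SameCycle x y := by
  obtain ⟨f1, f2, f3⟩ := classCount_bridges_add_le hρ h₀ hb hn
  obtain ⟨⟨z, hz, -⟩, -⟩ := exists_mem_bridges_kreweras hρ hb
  obtain ⟨κ, hκ⟩ := exists_isSideReturn P (ρ * π⁻¹)⁻¹
  have hprod : ρ⁻¹ * (ρ * π⁻¹)⁻¹⁻¹ = π⁻¹ := by group
  obtain ⟨g1, g2, g3⟩ := classCount_bridges_add_le (side_inv_apply hρ) hκ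
    ⟨z, by rw [bridges_inv]; exact hz.2⟩
    (by rw [hprod, numOrbits_inv, numOrbits_inv, numOrbits_inv]; omega)
  rw [hprod] at g1 g2 g3
  simp only [bridges_inv, orbitSetoid_inv] at g1 g2 g3
  have e1 := numOrbits_sideReturn h₀
  have e2 := numOrbits_kreweras hρ h₀
  refine ⟨by omega, fun x hx y hy hxy => ?_⟩
  by_cases hP : P x
  · exact rel_of_classCount_le_one (r := orbitSetoid (ρ * π₀⁻¹))
      (S := bridges P (ρ * π⁻¹) ∩ {x | P x}) (by omega)
      ⟨hx, hP⟩ ⟨hy, hxy.1 hP⟩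
  · exact rel_of_classCount_le_one (r := orbitSetoid (ρ * π₀⁻¹))
      (S := bridges P (ρ * π⁻¹) ∩ {x | ¬ P x}) (by omega)
      ⟨hx, hP⟩ ⟨hy, fun h => hP (hxy.2 h)⟩

end Complement

end Bridges

section Tau

theorem sameCycle_finRotate {n : ℕ} (i j : Fin n) : (finRotate n).SameCycle i j := by
  have key : ∀ k : ℕ, ∀ hk : k < n, (finRotate n).SameCycle ⟨0, by omega⟩ ⟨k, hk⟩ := by
    intro k
    induction k with
    | zero => exact fun _ => Equiv.Perm.SameCycle.refl _ _
    | succ k ih =>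
      intro hk
      obtain ⟨m, rfl⟩ : ∃ m, n = m + 1 := ⟨n - 1, by omega⟩
      have := ih (by omega)
      rw [← Equiv.Perm.sameCycle_apply_right, finRotate_of_lt (by omega)] at this
      exact this
  exact (key i i.2).symm.trans (key j j.2)

variable {p q : ℕ}

theorem tauPQ_side (x : Fin (p + q)) : ((tauPQ p q x : Fin (p + q)) : ℕ) < p ↔ (x : ℕ) < p := by
  obtain ⟨i | i, rfl⟩ := finSumFinEquiv.surjective x <;> simp [tauPQ]

theorem tauPQ_sameCycle {x y : Fin (p + q)} :
    (tauPQ p q).SameCycle x y ↔ ((x : ℕ) < p ↔ (y : ℕ) < p) := by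
  refine ⟨side_of_sameCycle (P := fun x : Fin (p + q) => (x : ℕ) < p) tauPQ_side, fun h => ?_⟩
  refine sameCycle_of_forall_eq fun f hf => ?_
  obtain ⟨i | i, rfl⟩ := finSumFinEquiv.surjective x <;>
  obtain ⟨j | j, rfl⟩ := finSumFinEquiv.surjective y
  · refine eq_of_sameCycle (σ := finRotate p)
      (f := fun i => f (finSumFinEquiv (Sum.inl i))) (fun z => ?_) (sameCycle_finRotate i j)
    simpa [tauPQ] using hf (finSumFinEquiv (Sum.inl z))
  · simp at h
  · simp at h
  · refine eq_of_sameCycle (σ := finRotate q)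
      (f := fun i => f (finSumFinEquiv (Sum.inr i))) (fun z => ?_) (sameCycle_finRotate i j)
    simpa [tauPQ] using hf (finSumFinEquiv (Sum.inr z))

theorem numOrbits_tauPQ_le : numOrbits (tauPQ p q) ≤ 2 := by
  have : Function.Injective (Quotient.lift (s := orbitSetoid (tauPQ p q))
      (fun x : Fin (p + q) => decide ((x : ℕ) < p))
      fun x y h => by simpa using tauPQ_sameCycle.1 h) := by
    intro c d
    induction c, d using Quotient.inductionOn₂ with
    | _ x y => exact fun h => Quotient.sound (tauPQ_sameCycle.2 (by simpa using h))
  simpa [numOrbits] using Nat.card_le_card_of_injective _ this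

theorem numJoin_of_le {α : Type*} {σ ρ : Equiv.Perm α}
    (h : ∀ x y, σ.SameCycle x y → ρ.SameCycle x y) : numJoin σ ρ = numOrbits ρ := by
  rw [numJoin, sup_eq_right.2 fun {x y} => h x y, numOrbits]

end Tau

end AnnNC

open AnnNC in
/-- with `I` the set of elements in bridges of `Kr⁻¹(π) = τπ⁻¹`, and `J` the
union of the two cycles of `ρ` containing the bridges of `π`, the set `K = I ∩ J` is the
union of exactly two cycles of `Kr_ρ⁻¹(π₀) = ρπ₀⁻¹`, one contained in each cycle
of `τ_{p,q}`. -/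
theorem stmt5 (p q : ℕ) (hp : 1 ≤ p) (hq : 1 ≤ q)
    (π ρ : Equiv.Perm (Fin (p + q))) (hπ : π ∈ SAnnNC p q) (hρ : ρ ∈ SDiscNC p q)
    (π₀ : Equiv.Perm (Fin (p + q))) (hπ₀ : IsPiZero p q π π₀)
    (hle : leAnnHat p q π ρ)
    (u v : Fin (p + q)) (hu : (u : ℕ) < p) (hv : p ≤ (v : ℕ))
    (hbr : ∀ x ∈ BridgeSet p q π, ρ.SameCycle u x ∨ ρ.SameCycle v x)
    (huB : ∃ a ∈ BridgeSet p q π, ρ.SameCycle u a)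
    (hvB : ∃ b ∈ BridgeSet p q π, ρ.SameCycle v b)
    (K : Set (Fin (p + q)))
    (hK : K = BridgeSet p q (tauPQ p q * π⁻¹) ∩ {x | ρ.SameCycle u x ∨ ρ.SameCycle v x}) :
    ∃ w₁ w₂ : Fin (p + q),
      (∀ x, (ρ * π₀⁻¹).SameCycle w₁ x → (x : ℕ) < p) ∧
      (∀ x, (ρ * π₀⁻¹).SameCycle w₂ x → p ≤ (x : ℕ)) ∧
      K = {x | (ρ * π₀⁻¹).SameCycle w₁ x} ∪ {x | (ρ * π₀⁻¹).SameCycle w₂ x} := by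
  set τ := tauPQ p q with hτ
  set P : Fin (p + q) → Prop := fun x => (x : ℕ) < p with hP
  have hB : ∀ σ : Equiv.Perm (Fin (p + q)), BridgeSet p q σ = bridges P σ := fun σ => by
    simp only [BridgeSet, bridges, hP, not_lt]
  simp only [hB] at hbr hK
  have h₀ : IsSideReturn P π π₀ := hπ₀
  have hρside : ∀ x, P (ρ x) ↔ P x := fun x =>
    (hρ.2 x (ρ x) (Equiv.Perm.sameCycle_apply_right.2 (Equiv.Perm.SameCycle.refl ρ x))).symm
  have hτside : ∀ x, P (τ x) ↔ P x := tauPQ_side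
  have hb : (bridges P π).Nonempty := by
    obtain ⟨a, b, h, ha, hb⟩ := hπ.2
    exact ⟨a, a, b, Equiv.Perm.SameCycle.refl π a, h, ha, not_lt.2 hb⟩
  have hδρ : τ * ρ⁻¹ * ρ = τ := by group
  have hδα : τ * ρ⁻¹ * (ρ * π⁻¹) = τ * π⁻¹ := by group
  have hδβ : τ * ρ⁻¹ * (ρ * π₀⁻¹) = τ * π₀⁻¹ := by group
  have c1 : numOrbits (π⁻¹ * τ) = numOrbits (τ * π⁻¹) := by
    rw [← numOrbits_conj (π⁻¹ * τ) τ]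
    congr 1
    group
  have c2 : numOrbits (ρ⁻¹ * τ) = numOrbits (τ * ρ⁻¹) := by
    rw [← numOrbits_conj (ρ⁻¹ * τ) τ]
    congr 1
    group
  have c3 : numOrbits ((ρ⁻¹ * τ)⁻¹ * (π⁻¹ * τ)) = numOrbits (ρ * π⁻¹) := by
    rw [← numOrbits_conj _ τ]
    congr 1
    group
  have n1 : numOrbits τ ≤ 2 := numOrbits_tauPQ_le
  have n2 : 1 ≤ numJoin π τ := by
    have : Nonempty (Quotient (orbitSetoid π ⊔ orbitSetoid τ)) := ⟨Quotient.mk _ u⟩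
    exact Nat.card_pos
  have n3 := hπ.1
  have n4 := hρ.1
  have n5 := hle.2
  rw [IsNoncrossingOn, euler] at n3 n4 n5
  rw [numJoin_of_le fun x y h => tauPQ_sameCycle.2 (hρ.2 x y h)] at n4
  rw [numJoin_of_le hle.1, c3] at n5
  rw [← hτ] at n3 n4 n5
  rw [c1] at n3 n5
  rw [c2] at n4 n5
  obtain ⟨r1, r2⟩ := kreweras_bridges hρside h₀ hb (by omega)
  obtain ⟨-, t2⟩ := kreweras_bridges hτside h₀ hb (by omega)
  have hβρ : ∀ x y, (ρ * π₀⁻¹).SameCycle x y → ρ.SameCycle x y := fun x y h => by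
    have := sameCycle_mul_of_left (ρ := π₀) (by rwa [inv_mul_cancel_right]) h
    rwa [inv_mul_cancel_right] at this
  have hsub : ∀ x ∈ bridges P (ρ * π⁻¹), x ∈ bridges P (τ * π⁻¹) := by
    rintro x ⟨a, b, ha, hb, h1, h2⟩
    have key : ∀ {y z}, (ρ * π⁻¹).SameCycle y z → (τ * π⁻¹).SameCycle y z := fun h => by
      have := sameCycle_mul_of_right (σ := τ * ρ⁻¹) (by rw [hδα]; omega) h
      rwa [hδα] at this
    exact ⟨a, b, key ha, key hb, h1, h2⟩
  have hmeet : ∀ x y, ρ.SameCycle x y → (τ * π₀⁻¹).SameCycle x y →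
      (ρ * π₀⁻¹).SameCycle x y := fun x y h1 h2 =>
    sameCycle_of_sameCycle_mul (σ := τ * ρ⁻¹) (by rw [hδρ]; omega) hβρ h1 (by rwa [hδβ])
  obtain ⟨⟨w₁, ⟨hw₁π, hw₁⟩, hw₁P⟩, ⟨w₂, ⟨hw₂π, hw₂⟩, hw₂P⟩⟩ :=
    exists_mem_bridges_kreweras hρside hb
  have hside : ∀ {x y}, ρ.SameCycle x y → (P x ↔ P y) := side_of_sameCycle hρside
  have hβside : ∀ {x y}, (ρ * π₀⁻¹).SameCycle x y → (P x ↔ P y) :=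
    side_of_sameCycle (side_kreweras hρside h₀)
  have hvP : ¬ P v := not_lt.2 hv
  have hu₁ : ρ.SameCycle u w₁ := (hbr w₁ hw₁π).resolve_right fun h => hvP ((hside h).2 hw₁P)
  have hv₂ : ρ.SameCycle v w₂ := (hbr w₂ hw₂π).resolve_left fun h => hw₂P ((hside h).1 hu)
  refine ⟨w₁, w₂, fun x hx => (hβside hx).1 hw₁P,
    fun x hx => not_lt.1 fun h => hw₂P ((hβside hx).2 h), ?_⟩
  rw [hK]
  ext x
  constructor
  · rintro ⟨hx, hux | hvx⟩
    · exact Or.inl (hmeet _ _ (hu₁.symm.trans hux)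
        (t2 _ (hsub _ hw₁) _ hx (iff_of_true hw₁P ((hside hux).1 hu))))
    · exact Or.inr (hmeet _ _ (hv₂.symm.trans hvx)
        (t2 _ (hsub _ hw₂) _ hx (iff_of_false hw₂P fun h => hvP ((hside hvx).2 h))))
  · rintro (hx | hx)
    · exact ⟨hsub _ (kreweras_closed hρside h₀ hw₁ hx), Or.inl (hu₁.trans (hβρ _ _ hx))⟩
    · exact ⟨hsub _ (kreweras_closed hρside h₀ hw₂ hx), Or.inr (hv₂.trans (hβρ _ _ hx))⟩
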